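/- The von Neumann neighborhood of radius one, N⁺ = {(1,0),(−1,0),(0,1),(0,−1)}, cannot perform crossing: there is no n and no vectors n̄,ē,s̄,w̄ ∈ E_n for which a crossing configuration exists. -/

import Mathlib

open Finset

/-- Vertices of the two-dimensional grid. -/
abbrev Vertex := ℤ × ℤ

/-- A configuration assigns a number of grains to each vertex. -/
abbrev Config := Vertex → ℕ

/-- Parallel abelian sandpile dynamics with uniform neighborhood `N`:
`F(c)(v) = c(v) - p·𝟙[c(v) ≥ p] + |{u | v - u ∈ N ∧ c(u) ≥ p}|` with `p = |N|`.
(The vertices `u` with `v - u ∈ N` are exactly the `v - d` for `d ∈ N`.) -/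
def sandF (N : Finset Vertex) (c : Config) : Config := fun v =>
  (c v - if N.card ≤ c v then N.card else 0)
    + (N.filter (fun d => N.card ≤ c (v - d))).card

/-- A configuration is stable when every vertex has fewer than `p = |N|` grains. -/
def Stable (N : Finset Vertex) (c : Config) : Prop := ∀ v, c v < N.card

/-- The set of unstable vertices of a configuration. -/
def Act (N : Finset Vertex) (c : Config) : Set Vertex := {v | N.card ≤ c v}

/-- A configuration is finite when only finitely many vertices carry grains. -/
def FiniteConf (c : Config) : Prop := {v | 0 < c v}.Finite

/-- A configuration has size `n × m` (positioned at the origin). -/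
def HasSize (n m : ℕ) (c : Config) : Prop :=
  ∀ v : Vertex, ¬(0 ≤ v.1 ∧ v.1 < (n : ℤ) ∧ 0 ≤ v.2 ∧ v.2 < (m : ℤ)) → c v = 0

/-- A vector of `E_n`: entries in `{0,1}`, supported on indices `< n`,
with exactly one entry equal to `1`. -/
def IsUnitVec (n : ℕ) (e : ℕ → ℕ) : Prop :=
  (∀ i, e i ≤ 1) ∧ (∀ i, n ≤ i → e i = 0) ∧ (∃! i, e i = 1)

/-- Positioning of a vector on the north border: `N(ē)(x,y) = ē(x)` if `y = 0`. -/
def confN (n : ℕ) (e : ℕ → ℕ) : Config := fun v =>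
  if v.2 = 0 ∧ 0 ≤ v.1 ∧ v.1 < (n : ℤ) then e v.1.toNat else 0

/-- Positioning of a vector on the south border: `S(ē)(x,y) = ē(x)` if `y = n-1`. -/
def confS (n : ℕ) (e : ℕ → ℕ) : Config := fun v =>
  if v.2 = (n : ℤ) - 1 ∧ 0 ≤ v.1 ∧ v.1 < (n : ℤ) then e v.1.toNat else 0

/-- Positioning of a vector on the west border: `W(ē)(x,y) = ē(y)` if `x = 0`. -/
def confW (n : ℕ) (e : ℕ → ℕ) : Config := fun v =>
  if v.1 = 0 ∧ 0 ≤ v.2 ∧ v.2 < (n : ℤ) then e v.2.toNat else 0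

/-- Positioning of a vector on the east border: `E(ē)(x,y) = ē(y)` if `x = n-1`. -/
def confE (n : ℕ) (e : ℕ → ℕ) : Config := fun v =>
  if v.1 = (n : ℤ) - 1 ∧ 0 ≤ v.2 ∧ v.2 < (n : ℤ) then e v.2.toNat else 0

/-- `c` is a transporter from west to east with vectors `w, e`. -/
def TransporterWE (N : Finset Vertex) (n : ℕ) (c : Config) (w e : ℕ → ℕ) : Prop :=
  ∃ t : ℕ, Act N ((sandF N)^[t] (c + confW n w)) = {v : Vertex | confE n e v = 1}

/-- `c` is a transporter from north to south with vectors `nv, s`. -/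
def TransporterNS (N : Finset Vertex) (n : ℕ) (c : Config) (nv s : ℕ → ℕ) : Prop :=
  ∃ t : ℕ, Act N ((sandF N)^[t] (c + confN n nv)) = {v : Vertex | confS n s v = 1}

/-- `c` has west vector `w` isolated to the south. -/
def IsolatedWS (N : Finset Vertex) (n : ℕ) (c : Config) (w : ℕ → ℕ) : Prop :=
  ∀ t : ℕ, ∀ v ∈ Act N ((sandF N)^[t] (c + confW n w)), v.2 ≠ (n : ℤ) - 1

/-- `c` has north vector `nv` isolated to the east. -/
def IsolatedNE (N : Finset Vertex) (n : ℕ) (c : Config) (nv : ℕ → ℕ) : Prop :=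
  ∀ t : ℕ, ∀ v ∈ Act N ((sandF N)^[t] (c + confN n nv)), v.1 ≠ (n : ℤ) - 1

/-- `c` is a crossing configuration of size `n × n` with vectors `nv, e, s, w ∈ E_n`. -/
def CrossingConfig (N : Finset Vertex) (n : ℕ) (c : Config)
    (nv e s w : ℕ → ℕ) : Prop :=
  IsUnitVec n nv ∧ IsUnitVec n e ∧ IsUnitVec n s ∧ IsUnitVec n w ∧
  Stable N c ∧ HasSize n n c ∧
  TransporterWE N n c w e ∧ IsolatedWS N n c w ∧
  TransporterNS N n c nv s ∧ IsolatedNE N n c nv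

/-- A neighborhood can perform crossing when some crossing configuration exists. -/
def CanCross (N : Finset Vertex) : Prop :=
  ∃ (n : ℕ) (c : Config) (nv e s w : ℕ → ℕ), CrossingConfig N n c nv e s w

/-- The neighborhood of a shape `s ⊆ ℝ²` with scaling ratio `r`. -/
def shapeNbhd (s : Set (ℝ × ℝ)) (r : ℝ) : Set Vertex :=
  {v : Vertex | (((v.1 : ℝ) / r, (v.2 : ℝ) / r) : ℝ × ℝ) ∈ s} \ {((0 : ℤ), (0 : ℤ))}

/-- A set `s ⊆ ℝ²` is non-flat when every point of `s` is a vertex of a triangle of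
strictly positive area (three non-collinear points) entirely contained in `s`. -/
def NonFlat (s : Set (ℝ × ℝ)) : Prop :=
  ∀ x ∈ s, ∃ b c : ℝ × ℝ, ¬ Collinear ℝ ({x, b, c} : Set (ℝ × ℝ)) ∧
    convexHull ℝ ({x, b, c} : Set (ℝ × ℝ)) ⊆ s

/-- The von Neumann neighborhood of radius one. -/
abbrev vonNeumann : Finset Vertex :=
  {((1 : ℤ), (0 : ℤ)), ((-1 : ℤ), (0 : ℤ)), ((0 : ℤ), (1 : ℤ)), ((0 : ℤ), (-1 : ℤ))}

/-- The configuration reached from `c` after `t` steps. -/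
def evolve (c : Config) (t : ℕ) : Config := (sandF vonNeumann)^[t] c

/-- Indicator of the unstable vertices. -/
def topple (c : Config) (v : Vertex) : ℕ := if 4 ≤ c v then 1 else 0

/-- Number of times `v` topples during the first `t` steps. -/
def odometer (c : Config) (t : ℕ) (v : Vertex) : ℕ := ∑ i ∈ range t, topple (evolve c i) v

/-- The vertex `v` topples at some time. -/
def Fires (c : Config) (v : Vertex) : Prop := ∃ t, 4 ≤ evolve c t v

/-- Adjacency in the square grid. -/
def GridAdj (u v : Vertex) : Prop :=
  (u.1 = v.1 ∧ (u.2 = v.2 + 1 ∨ v.2 = u.2 + 1)) ∨ (u.2 = v.2 ∧ (u.1 = v.1 + 1 ∨ v.1 = u.1 + 1))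

/-- The box `{0,…,n-1}²`. -/
def InBox (n : ℕ) (v : Vertex) : Prop := 0 ≤ v.1 ∧ v.1 < (n : ℤ) ∧ 0 ≤ v.2 ∧ v.2 < (n : ℤ)

theorem vonNeumann_card : vonNeumann.card = 4 := by decide

theorem sandF_add_topple (c : Config) (x y : ℤ) :
    sandF vonNeumann c (x, y) + 4 * topple c (x, y) = c (x, y) +
      (topple c (x - 1, y) + topple c (x + 1, y) + topple c (x, y - 1) + topple c (x, y + 1)) := by
  have hsum : (vonNeumann.filter (fun d => vonNeumann.card ≤ c ((x, y) - d))).card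
      = topple c (x - 1, y) + topple c (x + 1, y) + topple c (x, y - 1) + topple c (x, y + 1) := by
    rw [card_filter, vonNeumann_card, sum_insert (by decide), sum_insert (by decide),
      sum_insert (by decide), sum_singleton]
    simp [topple, add_assoc]
  unfold sandF
  rw [hsum, vonNeumann_card]
  have : topple c (x, y) = if 4 ≤ c (x, y) then 1 else 0 := rfl
  rw [this]
  split_ifs <;> omega

theorem evolve_succ (c : Config) (t : ℕ) : evolve c (t + 1) = sandF vonNeumann (evolve c t) :=
  Function.iterate_succ_apply' _ _ _

theorem odometer_succ (c : Config) (t : ℕ) (v : Vertex) :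
    odometer c (t + 1) v = odometer c t v + topple (evolve c t) v :=
  sum_range_succ _ _

theorem evolve_add_odometer (c : Config) (t : ℕ) (x y : ℤ) :
    evolve c t (x, y) + 4 * odometer c t (x, y) = c (x, y) +
      (odometer c t (x - 1, y) + odometer c t (x + 1, y) +
        odometer c t (x, y - 1) + odometer c t (x, y + 1)) := by
  induction t with
  | zero => simp [evolve, odometer]
  | succ t ih =>
    have h := sandF_add_topple (evolve c t) x y
    simp only [evolve_succ, odometer_succ]
    omega

theorem odometer_mono (c : Config) (v : Vertex) {s t : ℕ} (h : s ≤ t) :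
    odometer c s v ≤ odometer c t v :=
  sum_le_sum_of_subset (range_mono h)

theorem odometer_pos_iff (c : Config) (t : ℕ) (v : Vertex) :
    0 < odometer c t v ↔ ∃ i < t, 4 ≤ evolve c i v := by
  simp [odometer, topple, Nat.pos_iff_ne_zero]

/-- After adding one grain to a border vertex of a stable configuration supported on the box,
every vertex of the box topples at most once and no other vertex topples. -/
theorem odometer_le_box {n : ℕ} {c : Config} {src : Vertex} (hsize : HasSize n n c)
    (hstable : ∀ v, v ≠ src → c v ≤ 3) (hsrc : c src ≤ 4) (hborder : src.1 = 0 ∨ src.2 = 0)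
    (t : ℕ) : ∀ v, odometer c t v ≤ 1 ∧ (¬ InBox n v → odometer c t v = 0) := by
  induction t with
  | zero => simp [odometer]
  | succ t ih =>
    rintro ⟨x, y⟩
    rw [odometer_succ]
    by_cases hu : 4 ≤ evolve c t (x, y)
    · have h1 : topple (evolve c t) (x, y) = 1 := if_pos hu
      have hcons := evolve_add_odometer c t x y
      have ⟨a0, b0⟩ := ih (x, y)
      have ⟨a1, b1⟩ := ih (x - 1, y)
      have ⟨a2, b2⟩ := ih (x + 1, y)
      have ⟨a3, b3⟩ := ih (x, y - 1)
      have ⟨a4, b4⟩ := ih (x, y + 1)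
      have hout := hsize (x, y)
      simp only [InBox] at b0 b1 b2 b3 b4 hout ⊢
      by_cases hin : 0 ≤ x ∧ x < (n : ℤ) ∧ 0 ≤ y ∧ y < (n : ℤ)
      · refine ⟨?_, fun h => absurd hin h⟩
        by_cases hxy : (x, y) = src
        · subst hxy
          simp only at hborder
          omega
        · have := hstable _ hxy
          omega
      · have := hout hin
        omega
    · have h0 : topple (evolve c t) (x, y) = 0 := if_neg hu
      rw [h0]
      exact ih (x, y)

theorem Fires.inBox {n : ℕ} {c : Config} {v : Vertex}
    (hbox : ∀ t v, odometer c t v ≤ 1 ∧ (¬ InBox n v → odometer c t v = 0))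
    (hv : Fires c v) : InBox n v := by
  obtain ⟨t, ht⟩ := hv
  by_contra hn
  have h := (odometer_pos_iff c (t + 1) v).2 ⟨t, by omega, ht⟩
  have := (hbox (t + 1) v).2 hn
  omega

/-- A vertex toppling in the avalanche of `c` but not in that of `d` has a neighbor that
toppled earlier in the avalanche of `c` and does not topple in that of `d`. -/
theorem exists_earlier_neighbor {c d : Config} {v : Vertex} {t : ℕ}
    (honce : ∀ t u, odometer c t u ≤ 1) (hcd : c v ≤ d v)
    (ht : 4 ≤ evolve c t v) (hd : ¬ Fires d v) :
    ∃ u, GridAdj u v ∧ ¬ Fires d u ∧ ∃ s < t, 4 ≤ evolve c s u := by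
  by_contra! hno
  have key : ∀ u, GridAdj u v → ∃ T, odometer c t u ≤ odometer d T u := by
    intro u huv
    rcases Nat.eq_zero_or_pos (odometer c t u) with h0 | hpos
    · exact ⟨0, by omega⟩
    · obtain ⟨s, hst, hs⟩ := (odometer_pos_iff c t u).1 hpos
      have hfire : Fires d u := by
        by_contra hnf
        exact absurd hs (not_le.2 (hno u huv hnf s hst))
      obtain ⟨T, hT⟩ := hfire
      exact ⟨T + 1, (honce t u).trans ((odometer_pos_iff d (T + 1) u).2 ⟨T, by omega, hT⟩)⟩
  obtain ⟨x, y⟩ := v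
  obtain ⟨T1, h1⟩ := key (x - 1, y) (by simp [GridAdj])
  obtain ⟨T2, h2⟩ := key (x + 1, y) (by simp [GridAdj])
  obtain ⟨T3, h3⟩ := key (x, y - 1) (by simp [GridAdj])
  obtain ⟨T4, h4⟩ := key (x, y + 1) (by simp [GridAdj])
  set T := T1 + T2 + T3 + T4 with hT
  have m1 := odometer_mono d (x - 1, y) (show T1 ≤ T by omega)
  have m2 := odometer_mono d (x + 1, y) (show T2 ≤ T by omega)
  have m3 := odometer_mono d (x, y - 1) (show T3 ≤ T by omega)
  have m4 := odometer_mono d (x, y + 1) (show T4 ≤ T by omega)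
  have hc := evolve_add_odometer c t x y
  have hcons := evolve_add_odometer d T x y
  have hzero : odometer d T (x, y) = 0 := by
    by_contra hne
    obtain ⟨s, -, hs⟩ := (odometer_pos_iff d T (x, y)).1 (Nat.pos_of_ne_zero hne)
    exact hd ⟨s, hs⟩
  exact hd ⟨T, by omega⟩

/-- Induction along the part of the avalanche of `c` that avoids the avalanche of `d`. -/
theorem Fires.induction_avoiding {c d : Config} {src : Vertex}
    (honce : ∀ t u, odometer c t u ≤ 1) (hcd : ∀ v, v ≠ src → c v ≤ d v)
    {P : Vertex → Prop} (hsrc : ¬ Fires d src → P src)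
    (hstep : ∀ u v, Fires c u → ¬ Fires d u → Fires c v → ¬ Fires d v → GridAdj u v → P u → P v)
    {v : Vertex} (hv : Fires c v) (hd : ¬ Fires d v) : P v := by
  obtain ⟨t, ht⟩ := hv
  induction t using Nat.strong_induction_on generalizing v with
  | _ t ih =>
    by_cases hvs : v = src
    · subst hvs
      exact hsrc hd
    · obtain ⟨u, huv, hdu, s, hst, hs⟩ := exists_earlier_neighbor honce (hcd v hvs) ht hd
      exact hstep u v ⟨s, hs⟩ hdu ⟨t, ht⟩ hd huv (ih s hst hdu hs)

/-- Signed number of times that the step from `a` to `b` traverses the vertical half-line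
issued from `q + (1/2, 0)` towards decreasing second coordinates. -/
def rayCrossing (q a b : Vertex) : ℤ :=
  if a.2 < q.2 then (if q.1 < b.1 then 1 else 0) - (if q.1 < a.1 then 1 else 0) else 0

/-- Signed number of traversals of the half-line of `q` by the first `k` steps of `p`. -/
def pathCrossing (p : ℕ → Vertex) (k : ℕ) (q : Vertex) : ℤ :=
  ∑ i ∈ range k, rayCrossing q (p i) (p (i + 1))

theorem pathCrossing_vertical {p : ℕ → Vertex} {k : ℕ}
    (hp : ∀ i < k, GridAdj (p i) (p (i + 1))) {x y : ℤ} (hq : ∀ i ≤ k, p i ≠ (x, y)) :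
    pathCrossing p k (x, y + 1) = pathCrossing p k (x, y) := by
  refine sum_congr rfl fun i hi => ?_
  have hi' := mem_range.1 hi
  have hadj := hp i hi'
  have ha := hq i hi'.le
  have hb := hq (i + 1) hi'
  simp only [GridAdj, rayCrossing, ne_eq, Prod.ext_iff] at *
  split_ifs <;> omega

theorem pathCrossing_horizontal {p : ℕ → Vertex} {k : ℕ}
    (hp : ∀ i < k, GridAdj (p i) (p (i + 1))) {x y : ℤ} (hq : ∀ i ≤ k, p i ≠ (x + 1, y))
    (hstart : (p 0).1 ≠ x + 1) (hend : (p k).1 ≠ x + 1) :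
    pathCrossing p k (x + 1, y) = pathCrossing p k (x, y) := by
  let G : Vertex → ℤ := fun v => if v.2 < y ∧ v.1 = x + 1 then 1 else 0
  have htel := sum_range_sub (fun i => G (p i)) k
  have hG0 : G (p 0) = 0 := if_neg fun h => hstart h.2
  have hGk : G (p k) = 0 := if_neg fun h => hend h.2
  have hdiff : pathCrossing p k (x, y) - pathCrossing p k (x + 1, y)
      = ∑ i ∈ range k, (G (p (i + 1)) - G (p i)) := by
    rw [pathCrossing, pathCrossing, ← sum_sub_distrib]
    refine sum_congr rfl fun i hi => ?_
    have hi' := mem_range.1 hi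
    have hadj := hp i hi'
    have ha := hq i hi'.le
    have hb := hq (i + 1) hi'
    simp only [GridAdj, rayCrossing, ne_eq, Prod.ext_iff, G] at *
    split_ifs <;> omega
  rw [htel, hG0, hGk] at hdiff
  omega

theorem pathCrossing_adj {p : ℕ → Vertex} {k : ℕ}
    (hp : ∀ i < k, GridAdj (p i) (p (i + 1))) {u v : Vertex} (huv : GridAdj u v)
    (hu : ∀ i ≤ k, p i ≠ u) (hv : ∀ i ≤ k, p i ≠ v)
    (hstart : (p 0).1 ≤ u.1 ∧ (p 0).1 ≤ v.1) (hend : u.1 < (p k).1 ∧ v.1 < (p k).1) :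
    pathCrossing p k v = pathCrossing p k u := by
  obtain ⟨a, b⟩ := u
  obtain ⟨x, y⟩ := v
  simp only [GridAdj] at huv hstart hend
  rcases huv with ⟨rfl, rfl | rfl⟩ | ⟨rfl, rfl | rfl⟩
  · exact (pathCrossing_vertical hp hv).symm
  · exact pathCrossing_vertical hp hu
  · exact (pathCrossing_horizontal hp hu (by omega) (by omega)).symm
  · exact pathCrossing_horizontal hp hv (by omega) (by omega)

theorem pathCrossing_eq_zero {p : ℕ → Vertex} {k : ℕ} {q : Vertex}
    (h : ∀ i ≤ k, q.2 ≤ (p i).2) : pathCrossing p k q = 0 :=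
  sum_eq_zero fun i hi => if_neg (not_lt.2 (h i (mem_range.1 hi).le))

theorem pathCrossing_eq_one {p : ℕ → Vertex} {k : ℕ} {q : Vertex}
    (hp : ∀ i < k, GridAdj (p i) (p (i + 1))) (hq : ∀ i ≤ k, p i ≠ q)
    (h : ∀ i ≤ k, (p i).2 ≤ q.2) (hstart : (p 0).1 ≤ q.1) (hend : q.1 < (p k).1) :
    pathCrossing p k q = 1 := by
  have htel := sum_range_sub (fun i => if q.1 < (p i).1 then (1 : ℤ) else 0) k
  have heq : pathCrossing p k q = ∑ i ∈ range k,
      ((if q.1 < (p (i + 1)).1 then (1 : ℤ) else 0) - if q.1 < (p i).1 then (1 : ℤ) else 0) := by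
    refine sum_congr rfl fun i hi => ?_
    have hi' := mem_range.1 hi
    have hadj := hp i hi'
    have ha := hq i hi'.le
    have hb := hq (i + 1) hi'
    have hle := h i hi'.le
    simp only [GridAdj, rayCrossing, ne_eq, Prod.ext_iff] at *
    split_ifs <;> omega
  rw [heq, htel, if_pos hend, if_neg (not_lt.2 hstart), sub_zero]

/-- The avalanches of `c` and `d`, started at the west and north borders of the box, cannot reach
the east and south borders respectively if neither touches the target side of the other. -/
theorem avalanche_crossing_false {n : ℕ} {c d : Config} {w s e m : Vertex}
    (hc : ∀ t v, odometer c t v ≤ 1 ∧ (¬ InBox n v → odometer c t v = 0))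
    (hd : ∀ t v, odometer d t v ≤ 1 ∧ (¬ InBox n v → odometer d t v = 0))
    (hcd : ∀ v, v ≠ w → c v ≤ d v) (hdc : ∀ v, v ≠ m → d v ≤ c v)
    (hw : w.1 = 0) (hm : m.2 = 0) (he : e.1 = (n : ℤ) - 1) (hs : s.2 = (n : ℤ) - 1)
    (hce : Fires c e) (hds : Fires d s)
    (hcs : ∀ v, Fires c v → v.2 ≠ (n : ℤ) - 1) (hde : ∀ v, Fires d v → v.1 ≠ (n : ℤ) - 1) :
    False := by
  have hpath : ∃ (p : ℕ → Vertex) (k : ℕ), p 0 = w ∧ p k = e ∧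
      (∀ i < k, GridAdj (p i) (p (i + 1))) ∧ ∀ i ≤ k, Fires c (p i) ∧ ¬ Fires d (p i) := by
    refine Fires.induction_avoiding (c := c) (d := d) (src := w)
      (P := fun v => Fires c v → ∃ (p : ℕ → Vertex) (k : ℕ), p 0 = w ∧ p k = v ∧
      (∀ i < k, GridAdj (p i) (p (i + 1))) ∧ ∀ i ≤ k, Fires c (p i) ∧ ¬ Fires d (p i))
      (fun t u => (hc t u).1) hcd ?_ ?_ hce (fun h => hde e h he) hce
    · exact fun hnd hcw => ⟨fun _ => w, 0, rfl, rfl, by simp, fun _ _ => ⟨hcw, hnd⟩⟩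
    · intro u v hcu _ hcv hdv huv ih _
      obtain ⟨p, k, h0, hk, hp, hf⟩ := ih hcu
      refine ⟨fun i => if i ≤ k then p i else v, k + 1, by simp [h0], by simp, ?_, ?_⟩
      · intro i hi
        rcases (Nat.lt_succ_iff.1 hi).lt_or_eq with hlt | rfl
        · simpa [hlt.le, Nat.succ_le_of_lt hlt] using hp i hlt
        · simpa [hk] using huv
      · intro i _
        by_cases hik : i ≤ k
        · simpa [hik] using hf i hik
        · simpa [hik] using ⟨hcv, hdv⟩
  obtain ⟨p, k, h0, hk, hp, hf⟩ := hpath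
  have hoff : ∀ q, Fires d q → ∀ i ≤ k, p i ≠ q := by
    rintro q hq i hi rfl
    exact (hf i hi).2 hq
  have hpbox : ∀ i ≤ k, InBox n (p i) := fun i hi => (hf i hi).1.inBox hc
  have hcol : ∀ q, Fires d q → (p 0).1 ≤ q.1 ∧ q.1 < (p k).1 := by
    intro q hq
    have hb := hq.inBox hd
    have hne := hde q hq
    rw [h0, hk, hw, he]
    simp only [InBox] at hb
    omega
  have hzero : pathCrossing p k s = 0 := by
    refine Fires.induction_avoiding (c := d) (d := c) (src := m)
      (P := fun v => pathCrossing p k v = 0)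
      (fun t u => (hd t u).1) hdc ?_ ?_ hds (fun h => hcs s h hs)
    · refine fun _ => pathCrossing_eq_zero fun i hi => ?_
      rw [hm]
      exact (hpbox i hi).2.2.1
    · intro u v hu _ hv _ huv ih
      rw [pathCrossing_adj hp huv (hoff u hu) (hoff v hv) ⟨(hcol u hu).1, (hcol v hv).1⟩
        ⟨(hcol u hu).2, (hcol v hv).2⟩, ih]
  have hone : pathCrossing p k s = 1 := by
    refine pathCrossing_eq_one hp (hoff s hds) (fun i hi => ?_) (hcol s hds).1 (hcol s hds).2
    have := (hpbox i hi).2.2.2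
    omega
  omega

theorem IsUnitVec.exists_index {n : ℕ} {e : ℕ → ℕ} (he : IsUnitVec n e) :
    ∃ i < n, e i = 1 ∧ ∀ j, j ≠ i → e j = 0 := by
  obtain ⟨hle, hout, i, hi, huniq⟩ := he
  refine ⟨i, ?_, hi, fun j hj => ?_⟩
  · by_contra hn
    have := hout i (by omega)
    omega
  · have h1 := hle j
    have h2 : e j ≠ 1 := fun h => hj (huniq j h)
    omega

/-- the von Neumann neighborhood of radius one cannot perform crossing. -/
theorem stmt_5 :
    ¬ CanCross ({((1 : ℤ), (0 : ℤ)), ((-1 : ℤ), (0 : ℤ)),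
      ((0 : ℤ), (1 : ℤ)), ((0 : ℤ), (-1 : ℤ))} : Finset Vertex) := by
  rintro ⟨n, c, nv, e, s, w, hnv, he, hs, hw, hstable, hsize, ⟨t, ht⟩, hWS, ⟨t', ht'⟩, hNE⟩
  obtain ⟨a, han, ha, ha'⟩ := hw.exists_index
  obtain ⟨b, hbn, hb, hb'⟩ := hnv.exists_index
  obtain ⟨i, hin, hi, -⟩ := he.exists_index
  obtain ⟨j, hjn, hj, -⟩ := hs.exists_index
  have hW : ∀ v : Vertex, confW n w v ≤ 1 ∧ (v ≠ (0, (a : ℤ)) → confW n w v = 0) ∧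
      (¬ InBox n v → confW n w v = 0) := by
    rintro ⟨x, y⟩
    simp only [confW, InBox, ne_eq, Prod.mk.injEq]
    have hle := hw.1 y.toNat
    refine ⟨by split_ifs <;> omega, fun h => ?_, fun h => if_neg (by omega)⟩
    split_ifs with hxy
    · exact ha' _ (by omega)
    · rfl
  have hN : ∀ v : Vertex, confN n nv v ≤ 1 ∧ (v ≠ ((b : ℤ), 0) → confN n nv v = 0) ∧
      (¬ InBox n v → confN n nv v = 0) := by
    rintro ⟨x, y⟩
    simp only [confN, InBox, ne_eq, Prod.mk.injEq]
    have hle := hnv.1 x.toNat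
    refine ⟨by split_ifs <;> omega, fun h => ?_, fun h => if_neg (by omega)⟩
    split_ifs with hxy
    · exact hb' _ (by omega)
    · rfl
  have hc3 : ∀ v, c v ≤ 3 := fun v => Nat.le_of_lt_succ (hstable v)
  refine avalanche_crossing_false (n := n) (c := c + confW n w) (d := c + confN n nv)
    (w := (0, (a : ℤ))) (m := ((b : ℤ), 0)) (e := ((n : ℤ) - 1, (i : ℤ)))
    (s := ((j : ℤ), (n : ℤ) - 1))
    (odometer_le_box (src := (0, (a : ℤ))) ?_ ?_ ?_ (Or.inl rfl))
    (odometer_le_box (src := ((b : ℤ), 0)) ?_ ?_ ?_ (Or.inr rfl))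
    ?_ ?_ rfl rfl rfl rfl ⟨t, ?_⟩ ⟨t', ?_⟩ ?_ ?_
  · intro v hv
    simp [hsize v hv, (hW v).2.2 hv]
  · intro v hv
    simp [hc3 v, (hW v).2.1 hv]
  · exact Nat.add_le_add (hc3 _) (hW _).1
  · intro v hv
    simp [hsize v hv, (hN v).2.2 hv]
  · intro v hv
    simp [hc3 v, (hN v).2.1 hv]
  · exact Nat.add_le_add (hc3 _) (hN _).1
  · intro v hv
    simp [(hW v).2.1 hv]
  · intro v hv
    simp [(hN v).2.1 hv]
  · have hmem : ((n : ℤ) - 1, (i : ℤ)) ∈ {v : Vertex | confE n e v = 1} := by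
      simp [confE, hin, hi]
    rw [← ht] at hmem
    exact hmem
  · have hmem : ((j : ℤ), (n : ℤ) - 1) ∈ {v : Vertex | confS n s v = 1} := by
      simp [confS, hjn, hj]
    rw [← ht'] at hmem
    exact hmem
  · rintro v ⟨T, hT⟩
    exact hWS T v hT
  · rintro v ⟨T, hT⟩
    exact hNE T v hT
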